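/- The sequence R_3(n)/n² converges to 2/3 as n → ∞; equivalently, R_3(n) ~ (2/3)n². -/

import Mathlib

/-- The `i`-th largest part (1-indexed) of a partition, or `0` if out of range. -/
def part {n : ℕ} (p : n.Partition) (i : ℕ) : ℕ :=
  (p.parts.sort (· ≥ ·)).getD (i - 1) 0

open Classical in
/-- The size of the Durfee triangle of a partition: the largest `k` such that
`λ_i ≥ k + 1 - i` for all `1 ≤ i ≤ k`. -/
noncomputable def durfee {n : ℕ} (p : n.Partition) : ℕ :=
  Nat.findGreatest (fun k => ∀ i ∈ Finset.Icc 1 k, k + 1 ≤ part p i + i) n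

open Classical in
/-- `R k n` : the number of partitions of `n` with Durfee triangle size exactly `k`. -/
noncomputable def R (k n : ℕ) : ℕ :=
  (Finset.univ.filter fun p : n.Partition => durfee p = k).card

/-- The partition function. -/
def P (n : ℕ) : ℕ := Fintype.card n.Partition

/-- The maximal Durfee triangle size among partitions of `n`. -/
noncomputable def F (n : ℕ) : ℕ := Finset.univ.sup fun p : n.Partition => durfee p

/-- Index set: pairs `(x, y)` with `p x + q y ≤ n`. -/
def pairs (p q n : ℕ) : Finset (Σ _ : ℕ, ℕ) :=
  (Finset.range (n / p + 1)).sigma fun x => Finset.range ((n - p * x) / q + 1)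

theorem mem_pairs2 (n : ℕ) (z : Σ _ : ℕ, ℕ) : z ∈ pairs 2 1 n ↔ 2 * z.1 + z.2 ≤ n := by
  simp only [pairs, Finset.mem_sigma, Finset.mem_range]; omega

theorem mem_pairs3 (n : ℕ) (z : Σ _ : ℕ, ℕ) : z ∈ pairs 3 2 n ↔ 3 * z.1 + 2 * z.2 ≤ n := by
  simp only [pairs, Finset.mem_sigma, Finset.mem_range]; omega

theorem card_pairs2_rec (n : ℕ) : (pairs 2 1 (n + 2)).card = (pairs 2 1 n).card + (n + 3) := by
  simp only [pairs, Finset.card_sigma, Finset.card_range]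
  rw [show (n + 2) / 2 + 1 = (n / 2 + 1) + 1 by omega, Finset.sum_range_succ']
  congr 1
  · refine Finset.sum_congr rfl fun x _ => ?_
    omega
  · omega

theorem card_pairs3_rec (n : ℕ) :
    (pairs 3 2 (n + 3)).card = (pairs 3 2 n).card + ((n + 3) / 2 + 1) := by
  simp only [pairs, Finset.card_sigma, Finset.card_range]
  rw [show (n + 3) / 3 + 1 = (n / 3 + 1) + 1 by omega, Finset.sum_range_succ']
  congr 1
  refine Finset.sum_congr rfl fun x _ => ?_
  omega

theorem card_pairs2 (n : ℕ) :
    n ^ 2 ≤ 4 * (pairs 2 1 n).card ∧ 4 * (pairs 2 1 n).card ≤ (n + 3) ^ 2 := by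
  induction n using Nat.strong_induction_on with
  | _ n ih =>
    match n with
    | 0 => decide
    | 1 => decide
    | n + 2 =>
      have := ih n (by omega)
      rw [card_pairs2_rec]
      constructor <;> nlinarith

theorem card_pairs3 (n : ℕ) :
    n ^ 2 ≤ 12 * (pairs 3 2 n).card ∧ 12 * (pairs 3 2 n).card ≤ (n + 6) ^ 2 := by
  induction n using Nat.strong_induction_on with
  | _ n ih =>
    match n with
    | 0 => decide
    | 1 => decide
    | 2 => decide
    | n + 3 =>
      have := ih n (by omega)
      rw [card_pairs3_rec]
      have h1 : 2 * ((n + 3) / 2) ≤ n + 3 := by omega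
      have h2 : n + 2 ≤ 2 * ((n + 3) / 2) := by omega
      constructor <;> nlinarith

/-- Lists of parts in decreasing order, for Durfee triangle size three. -/
def Good (n : ℕ) (l : List ℕ) : Prop :=
  l.Pairwise (· ≥ ·) ∧ (∀ x ∈ l, 0 < x) ∧ l.sum = n ∧
    (3 ≤ l.getD 0 0 ∧ 2 ≤ l.getD 1 0 ∧ 1 ≤ l.getD 2 0) ∧
    ¬ (4 ≤ l.getD 0 0 ∧ 3 ≤ l.getD 1 0 ∧ 2 ≤ l.getD 2 0 ∧ 1 ≤ l.getD 3 0)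

theorem durfee_eq_three {n : ℕ} (hn : 4 ≤ n) (p : n.Partition) :
    durfee p = 3 ↔ (3 ≤ part p 1 ∧ 2 ≤ part p 2 ∧ 1 ≤ part p 3) ∧
      ¬ (4 ≤ part p 1 ∧ 3 ≤ part p 2 ∧ 2 ≤ part p 3 ∧ 1 ≤ part p 4) := by
  unfold durfee
  refine (@Nat.findGreatest_eq_iff _ _ _ (fun _ => Classical.propDecidable _)).trans ?_
  constructor
  · rintro ⟨_, h3, h4⟩
    have h3 := h3 (by norm_num)
    have h4 := h4 (n := 4) (by norm_num) hn
    have e1 := h3 1 (by simp)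
    have e2 := h3 2 (by simp)
    have e3 := h3 3 (by simp)
    refine ⟨⟨by omega, by omega, by omega⟩, fun h => h4 fun i hi => ?_⟩
    rw [Finset.mem_Icc] at hi
    obtain ⟨a, b⟩ := hi
    interval_cases i <;> omega
  · rintro ⟨h3, h4⟩
    refine ⟨by omega, fun _ i hi => ?_, fun m hm _ h => h4 ?_⟩
    · rw [Finset.mem_Icc] at hi
      obtain ⟨a, b⟩ := hi
      interval_cases i <;> omega
    · have e1 := h 1 (by simp; omega)
      have e2 := h 2 (by simp; omega)
      have e3 := h 3 (by simp; omega)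
      have e4 := h 4 (by simp; omega)
      omega

theorem good_sort {n : ℕ} (hn : 4 ≤ n) (p : n.Partition) (h : durfee p = 3) :
    Good n (p.parts.sort (· ≥ ·)) := by
  rw [durfee_eq_three hn] at h
  refine ⟨Multiset.pairwise_sort _ _, fun x hx => ?_, ?_, ?_⟩
  · exact p.parts_pos ((Multiset.mem_sort _).1 hx)
  · rw [← Multiset.sum_coe, Multiset.sort_eq]
    exact p.parts_sum
  · simpa [part] using h

theorem exists_of_good {n : ℕ} (hn : 4 ≤ n) (l : List ℕ) (h : Good n l) :
    ∃ p : n.Partition, durfee p = 3 ∧ p.parts.sort (· ≥ ·) = l := by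
  obtain ⟨h1, h2, h3, h4⟩ := h
  let p : n.Partition := ⟨(l : Multiset ℕ), fun {i} hi => h2 i (by simpa using hi), by simpa using h3⟩
  have hp : p.parts.sort (· ≥ ·) = l := by
    refine List.Perm.eq_of_pairwise' (Multiset.pairwise_sort _ _) h1 ?_
    rw [← Multiset.coe_eq_coe, Multiset.sort_eq]
  refine ⟨p, ?_, hp⟩
  rw [durfee_eq_three hn]
  unfold part
  rw [hp]
  simpa using h4

open Classical in
/-- The set of sorted lists of parts counted by `R 3 n`. -/
noncomputable def lists (n : ℕ) : Finset (List ℕ) :=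
  (Finset.univ.filter fun p : n.Partition => durfee p = 3).image fun p => p.parts.sort (· ≥ ·)

theorem card_lists (n : ℕ) : (lists n).card = R 3 n := by
  unfold lists R
  apply Finset.card_image_of_injective
  intro p q h
  apply Nat.Partition.ext
  have h : p.parts.sort (· ≥ ·) = q.parts.sort (· ≥ ·) := h
  rw [← Multiset.sort_eq p.parts (· ≥ ·), h, Multiset.sort_eq]

theorem mem_lists {n : ℕ} (hn : 4 ≤ n) (l : List ℕ) : l ∈ lists n ↔ Good n l := by
  unfold lists
  simp only [Finset.mem_image, Finset.mem_filter, Finset.mem_univ, true_and]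
  constructor
  · rintro ⟨p, hp, rfl⟩
    exact good_sort hn p hp
  · exact exists_of_good hn l

/-- Third part one. -/
def fC (n : ℕ) (z : Σ _ : ℕ, ℕ) : List ℕ := (n - z.1 - z.2) :: z.1 :: List.replicate z.2 1
/-- Second part two. -/
def fD (n : ℕ) (z : Σ _ : ℕ, ℕ) : List ℕ :=
  (n - 2 * z.1 - z.2) :: (List.replicate z.1 2 ++ List.replicate z.2 1)
/-- Three parts. -/
def fA (n : ℕ) (z : Σ _ : ℕ, ℕ) : List ℕ := [n - 2 * z.1 - z.2, z.1 + z.2, z.1]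
/-- Largest part three. -/
def fB (n : ℕ) (z : Σ _ : ℕ, ℕ) : List ℕ :=
  List.replicate z.1 3 ++ (List.replicate z.2 2 ++ List.replicate (n - 3 * z.1 - 2 * z.2) 1)

theorem sorted_le_three (l : List ℕ) (h : l.Pairwise (· ≥ ·)) (hp : ∀ x ∈ l, 0 < x ∧ x ≤ 3) :
    ∃ i j k, l = List.replicate i 3 ++ (List.replicate j 2 ++ List.replicate k 1) := by
  induction l with
  | nil => exact ⟨0, 0, 0, rfl⟩
  | cons a t ih =>
    rw [List.pairwise_cons] at h
    obtain ⟨i, j, k, e⟩ := ih h.2 fun x hx => hp x (List.mem_cons_of_mem _ hx)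
    have ha := hp a (by simp)
    have h1 := h.1
    have : a = 3 ∨ a = 2 ∨ a = 1 := by omega
    rcases this with rfl | rfl | rfl
    · exact ⟨i + 1, j, k, by simp [e, List.replicate_succ]⟩
    · obtain rfl : i = 0 := by
        by_contra hi
        have := h1 3 (by simp [e, hi])
        omega
      exact ⟨0, j + 1, k, by simp [e, List.replicate_succ]⟩
    · obtain rfl : i = 0 := by
        by_contra hi
        have := h1 3 (by simp [e, hi])
        omega
      obtain rfl : j = 0 := by
        by_contra hi
        have := h1 2 (by simp [e, hi])
        omega
      exact ⟨0, 0, k + 1, by simp [e, List.replicate_succ]⟩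

theorem good_cases (n : ℕ) (l : List ℕ) (h : Good n l) :
    (∃ z ∈ pairs 2 1 n, fC n z = l) ∨ (∃ z ∈ pairs 2 1 n, fD n z = l) ∨
    (∃ z ∈ pairs 3 2 n, fA n z = l) ∨ (∃ z ∈ pairs 3 2 n, fB n z = l) := by
  simp only [mem_pairs2, mem_pairs3]
  obtain ⟨h1, h2, h3, ⟨ha, hb, hc⟩, h5⟩ := h
  match l with
  | [] => simp at ha
  | [a] => simp at hb
  | [a, b] => simp at hc
  | a :: b :: c :: t =>
    simp only [List.getD_cons_zero, List.getD_cons_succ] at ha hb hc h5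
    simp only [List.pairwise_cons] at h1
    obtain ⟨p1, p2, p3, p4⟩ := h1
    have hab := p1 b (by simp)
    have hbc := p2 c (by simp)
    simp only [List.sum_cons] at h3
    by_cases c1 : c = 1
    · left
      have ht : t = List.replicate t.length 1 := by
        rw [List.eq_replicate_iff]
        refine ⟨rfl, fun x hx => ?_⟩
        have := p3 x hx
        have := h2 x (by simp [hx])
        omega
      generalize t.length = m at ht
      subst ht
      simp at h3
      refine ⟨⟨b, m + 1⟩, by simp only; omega, ?_⟩
      simp only [fC, c1, List.replicate_succ]
      congr 1
      omega
    by_cases b2 : b = 2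
    · right; left
      obtain ⟨i, j, k, e⟩ := sorted_le_three (b :: c :: t)
        (by simp only [List.pairwise_cons]; exact ⟨p2, p3, p4⟩) (by
          intro x hx
          refine ⟨h2 x (List.mem_cons_of_mem _ hx), ?_⟩
          rcases List.mem_cons.1 hx with rfl | hx
          · omega
          · have := p2 x hx
            omega)
      obtain rfl : i = 0 := by
        by_contra hi
        obtain ⟨i, rfl⟩ := Nat.exists_eq_succ_of_ne_zero hi
        simp [List.replicate_succ] at e
        omega
      have hs := congrArg List.sum e
      simp at hs
      refine ⟨⟨j, k⟩, by simp only; omega, ?_⟩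
      simp only [fD]
      rw [e]
      simp only [List.replicate_zero, List.nil_append]
      congr 1
      omega
    by_cases t0 : t = []
    · right; right; left
      subst t0
      simp at h3
      refine ⟨⟨c, b - c⟩, by simp only; omega, ?_⟩
      simp only [fA]
      congr 1
      · omega
      · congr 1
        omega
    · right; right; right
      obtain ⟨d, s, rfl⟩ := List.exists_cons_of_ne_nil t0
      have hd := h2 d (by simp)
      simp only [List.getD_cons_zero] at h5
      have ha3 : a = 3 := by omega
      obtain ⟨i, j, k, e⟩ := sorted_le_three (a :: b :: c :: d :: s)
        (by rw [List.pairwise_cons, List.pairwise_cons, List.pairwise_cons]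
            exact ⟨p1, p2, p3, p4⟩) (by
          intro x hx
          refine ⟨h2 x hx, ?_⟩
          rcases List.mem_cons.1 hx with rfl | hx
          · omega
          · have := p1 x hx
            omega)
      have hs := congrArg List.sum e
      simp at hs h3
      refine ⟨⟨i, j⟩, by simp only; omega, ?_⟩
      simp only [fB]
      rw [e]
      congr 3
      omega

theorem R_upper {n : ℕ} (hn : 4 ≤ n) :
    R 3 n ≤ 2 * (pairs 2 1 n).card + 2 * (pairs 3 2 n).card := by
  rw [← card_lists]
  have hsub : lists n ⊆ ((pairs 2 1 n).image (fC n) ∪ (pairs 2 1 n).image (fD n)) ∪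
      ((pairs 3 2 n).image (fA n) ∪ (pairs 3 2 n).image (fB n)) := by
    intro l hl
    have := good_cases n l ((mem_lists hn l).1 hl)
    simp only [Finset.mem_union, Finset.mem_image]
    rw [or_assoc]
    exact this
  have h0 := Finset.card_le_card hsub
  have h1 := Finset.card_union_le ((pairs 2 1 n).image (fC n) ∪ (pairs 2 1 n).image (fD n))
    ((pairs 3 2 n).image (fA n) ∪ (pairs 3 2 n).image (fB n))
  have h2 := Finset.card_union_le ((pairs 2 1 n).image (fC n)) ((pairs 2 1 n).image (fD n))
  have h3 := Finset.card_union_le ((pairs 3 2 n).image (fA n)) ((pairs 3 2 n).image (fB n))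
  have h4 := Finset.card_image_le (s := pairs 2 1 n) (f := fC n)
  have h5 := Finset.card_image_le (s := pairs 2 1 n) (f := fD n)
  have h6 := Finset.card_image_le (s := pairs 3 2 n) (f := fA n)
  have h7 := Finset.card_image_le (s := pairs 3 2 n) (f := fB n)
  omega

/-- Shift of a pair away from the boundary. -/
def sh (z : Σ _ : ℕ, ℕ) : Σ _ : ℕ, ℕ := ⟨z.1 + 4, z.2 + 4⟩

theorem good_fC (m : ℕ) (z : Σ _ : ℕ, ℕ) (hz : 2 * z.1 + z.2 ≤ m) :
    Good (m + 28) (fC (m + 28) (sh z)) ∧ (fC (m + 28) (sh z)).getD 2 0 = 1 := by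
  obtain ⟨x, y⟩ := z
  simp only at hz
  simp only [fC, sh]
  refine ⟨⟨?_, ?_, ?_, ?_⟩, ?_⟩
  · simp [List.pairwise_cons, List.pairwise_replicate]
    omega
  · simp
    omega
  · simp
    omega
  · simp [List.replicate_succ]
    omega
  · simp [List.replicate_succ]

theorem good_fD (m : ℕ) (z : Σ _ : ℕ, ℕ) (hz : 2 * z.1 + z.2 ≤ m) :
    Good (m + 28) (fD (m + 28) (sh z)) ∧ (fD (m + 28) (sh z)).getD 2 0 = 2 := by
  obtain ⟨x, y⟩ := z
  simp only at hz
  simp only [fD, sh]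
  refine ⟨⟨?_, ?_, ?_, ?_⟩, ?_⟩
  · simp [List.pairwise_cons, List.pairwise_append, List.pairwise_replicate]
    omega
  · simp
    omega
  · simp
    omega
  · simp [List.replicate_succ]
    omega
  · simp [List.replicate_succ]

theorem good_fA (m : ℕ) (z : Σ _ : ℕ, ℕ) (hz : 3 * z.1 + 2 * z.2 ≤ m) :
    Good (m + 28) (fA (m + 28) (sh z)) ∧ 4 ≤ (fA (m + 28) (sh z)).getD 2 0 := by
  obtain ⟨x, y⟩ := z
  simp only at hz
  simp only [fA, sh]
  refine ⟨⟨?_, ?_, ?_, ?_⟩, ?_⟩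
  · simp [List.pairwise_cons]
    omega
  · simp
    omega
  · simp
    omega
  · simp
    omega
  · simp

theorem good_fB (m : ℕ) (z : Σ _ : ℕ, ℕ) (hz : 3 * z.1 + 2 * z.2 ≤ m) :
    Good (m + 28) (fB (m + 28) (sh z)) ∧ (fB (m + 28) (sh z)).getD 2 0 = 3 := by
  obtain ⟨x, y⟩ := z
  simp only at hz
  simp only [fB, sh]
  refine ⟨⟨?_, ?_, ?_, ?_⟩, ?_⟩
  · simp only [List.pairwise_append, List.pairwise_replicate, List.mem_append, List.mem_replicate]
    refine ⟨by simp, ⟨by simp, by simp, ?_⟩, ?_⟩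
    · rintro a ⟨_, rfl⟩ b ⟨_, rfl⟩
      norm_num
    · rintro a ⟨_, rfl⟩ b (⟨_, rfl⟩ | ⟨_, rfl⟩) <;> norm_num
  · simp only [List.mem_append, List.mem_replicate]
    rintro a (⟨_, rfl⟩ | ⟨_, rfl⟩ | ⟨_, rfl⟩) <;> norm_num
  · simp
    omega
  · simp [List.replicate_succ]
  · simp [List.replicate_succ]

theorem inj_fC (m : ℕ) : Set.InjOn (fun z => fC (m + 28) (sh z)) (pairs 2 1 m) := by
  rintro ⟨x, y⟩ hz ⟨x', y'⟩ hz' h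
  rw [Finset.mem_coe, mem_pairs2] at hz hz'
  have h1 := congrArg List.length h
  have h2 := congrArg (fun l => l.getD 1 0) h
  simp [fC, sh] at h1 h2
  subst h1 h2
  rfl

theorem inj_fD (m : ℕ) : Set.InjOn (fun z => fD (m + 28) (sh z)) (pairs 2 1 m) := by
  rintro ⟨x, y⟩ hz ⟨x', y'⟩ hz' h
  rw [Finset.mem_coe, mem_pairs2] at hz hz'
  have h1 := congrArg List.length h
  have h2 := congrArg (fun l => l.getD 0 0) h
  simp [fD, sh] at h1 h2 hz hz'
  obtain rfl : x = x' := by omega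
  obtain rfl : y = y' := by omega
  rfl

theorem inj_fA (m : ℕ) : Set.InjOn (fun z => fA (m + 28) (sh z)) (pairs 3 2 m) := by
  rintro ⟨x, y⟩ hz ⟨x', y'⟩ hz' h
  have h1 := congrArg (fun l => l.getD 1 0) h
  have h2 := congrArg (fun l => l.getD 2 0) h
  simp [fA, sh] at h1 h2
  obtain rfl : x = x' := by omega
  obtain rfl : y = y' := by omega
  rfl

theorem inj_fB (m : ℕ) : Set.InjOn (fun z => fB (m + 28) (sh z)) (pairs 3 2 m) := by
  rintro ⟨x, y⟩ hz ⟨x', y'⟩ hz' h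
  have h1 := congrArg (List.count 3) h
  have h2 := congrArg (List.count 2) h
  simp [fB, sh, List.count_replicate] at h1 h2
  obtain rfl : x = x' := by omega
  obtain rfl : y = y' := by omega
  rfl

theorem R_lower (m : ℕ) :
    2 * (pairs 2 1 m).card + 2 * (pairs 3 2 m).card ≤ R 3 (m + 28) := by
  rw [← card_lists]
  have hC : ∀ l ∈ (pairs 2 1 m).image (fun z => fC (m + 28) (sh z)),
      Good (m + 28) l ∧ l.getD 2 0 = 1 := by
    intro l hl
    obtain ⟨z, hz, rfl⟩ := Finset.mem_image.1 hl
    exact good_fC m z ((mem_pairs2 m z).1 hz)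
  have hD : ∀ l ∈ (pairs 2 1 m).image (fun z => fD (m + 28) (sh z)),
      Good (m + 28) l ∧ l.getD 2 0 = 2 := by
    intro l hl
    obtain ⟨z, hz, rfl⟩ := Finset.mem_image.1 hl
    exact good_fD m z ((mem_pairs2 m z).1 hz)
  have hA : ∀ l ∈ (pairs 3 2 m).image (fun z => fA (m + 28) (sh z)),
      Good (m + 28) l ∧ 4 ≤ l.getD 2 0 := by
    intro l hl
    obtain ⟨z, hz, rfl⟩ := Finset.mem_image.1 hl
    exact good_fA m z ((mem_pairs3 m z).1 hz)
  have hB : ∀ l ∈ (pairs 3 2 m).image (fun z => fB (m + 28) (sh z)),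
      Good (m + 28) l ∧ l.getD 2 0 = 3 := by
    intro l hl
    obtain ⟨z, hz, rfl⟩ := Finset.mem_image.1 hl
    exact good_fB m z ((mem_pairs3 m z).1 hz)
  have cC := Finset.card_image_of_injOn (inj_fC m)
  have cD := Finset.card_image_of_injOn (inj_fD m)
  have cA := Finset.card_image_of_injOn (inj_fA m)
  have cB := Finset.card_image_of_injOn (inj_fB m)
  generalize (pairs 2 1 m).image (fun z => fC (m + 28) (sh z)) = C at *
  generalize (pairs 2 1 m).image (fun z => fD (m + 28) (sh z)) = D at *
  generalize (pairs 3 2 m).image (fun z => fA (m + 28) (sh z)) = A at *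
  generalize (pairs 3 2 m).image (fun z => fB (m + 28) (sh z)) = B at *
  have hsub : (C ∪ D) ∪ (A ∪ B) ⊆ lists (m + 28) := by
    intro l hl
    rw [mem_lists (by omega)]
    simp only [Finset.mem_union] at hl
    rcases hl with (h | h) | (h | h)
    exacts [(hC l h).1, (hD l h).1, (hA l h).1, (hB l h).1]
  have d1 : Disjoint C D := by
    rw [Finset.disjoint_left]
    intro l h h'
    have := hC l h
    have := hD l h'
    omega
  have d2 : Disjoint A B := by
    rw [Finset.disjoint_left]
    intro l h h'
    have := hA l h
    have := hB l h'
    omega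
  have d3 : Disjoint (C ∪ D) (A ∪ B) := by
    rw [Finset.disjoint_left]
    intro l h h'
    have e1 : l.getD 2 0 ≤ 2 := by
      rcases Finset.mem_union.1 h with h | h
      · have := hC l h
        omega
      · have := hD l h
        omega
    rcases Finset.mem_union.1 h' with h | h
    · have := hA l h
      omega
    · have := hB l h
      omega
  have h0 := Finset.card_le_card hsub
  rw [Finset.card_union_of_disjoint d3, Finset.card_union_of_disjoint d1,
    Finset.card_union_of_disjoint d2] at h0
  omega

theorem R_three_asymptotic :
    Filter.Tendsto (fun n : ℕ => (R 3 n : ℝ) / (n : ℝ) ^ 2) Filter.atTop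
      (nhds (2 / 3)) := by
  have key : ∀ c : ℝ, Filter.Tendsto (fun n : ℕ => 2 / 3 * (1 + c / (n : ℝ)) ^ 2) Filter.atTop
      (nhds (2 / 3)) := by
    intro c
    have h := tendsto_const_div_atTop_nhds_zero_nat c
    have := (((h.const_add 1).pow 2).const_mul (2 / 3 : ℝ))
    simpa using this
  refine tendsto_of_tendsto_of_tendsto_of_le_of_le' (key (-28)) (key 6) ?_ ?_
  · filter_upwards [Filter.eventually_ge_atTop 28] with n hn
    obtain ⟨m, rfl⟩ := Nat.exists_eq_add_of_le' hn
    have h1 := R_lower m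
    have h2 := (card_pairs2 m).1
    have h3 := (card_pairs3 m).1
    generalize R 3 (m + 28) = r at *
    have h4 : 2 * m ^ 2 ≤ 3 * r := by omega
    have h5 : (2 : ℝ) * (m : ℝ) ^ 2 ≤ 3 * (r : ℝ) := by exact_mod_cast h4
    have hpos : (0 : ℝ) < ((m + 28 : ℕ) : ℝ) := by positivity
    rw [le_div_iff₀ (by positivity), mul_assoc, ← mul_pow, add_mul, div_mul_cancel₀ _ hpos.ne']
    have h6 : ((m + 28 : ℕ) : ℝ) = (m : ℝ) + 28 := by push_cast; ring
    have h7 : 1 * ((m + 28 : ℕ) : ℝ) + -28 = (m : ℝ) := by rw [h6]; ring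
    rw [h7]
    linarith
  · filter_upwards [Filter.eventually_ge_atTop 28] with n hn
    have h1 := R_upper (n := n) (by omega)
    have h2 := (card_pairs2 n).2
    have h3 := (card_pairs3 n).2
    have h4 : 3 * R 3 n ≤ 2 * (n + 6) ^ 2 := by nlinarith
    have h5 : (3 : ℝ) * R 3 n ≤ 2 * (n + 6) ^ 2 := by exact_mod_cast h4
    have hpos : (0 : ℝ) < (n : ℝ) := by
      have : 0 < n := by omega
      exact_mod_cast this
    rw [div_le_iff₀ (by positivity), mul_assoc, ← mul_pow, add_mul, div_mul_cancel₀ _ hpos.ne']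
    nlinarith
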